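/- Let p ∈ [1,∞) and let Q ∈ L_p(M₂) be a Dirac-form potential. Then there exists a measurable M₂-valued kernel K = K_Q on the triangle {(x,t) : 0 ≤ t ≤ x ≤ 1}, with K(x,·) ∈ L_p((0,x), M₂) for every x, such that for every λ ∈ ℂ and every x ∈ [0,1] the solution c(·,λ) of ℓ_Q u = λu with c(0,λ) = (1,0)ᵗ satisfies c(x,λ) = c₀(x,λ) + ∫₀ˣ K(x,t) c₀(t,λ) dt, where c₀(x,λ) := (cos λx, sin λx)ᵗ. -/

import Mathlib

open MeasureTheory Complex Filter Set
open scoped Matrix.Norms.L2Operator ENNReal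

noncomputable section

abbrev M2 := Matrix (Fin 2) (Fin 2) ℂ

def Bmat : M2 := !![0, 1; -1, 0]

def Jmat : M2 := !![1, 0; 0, -1]

/-- `expB τ = e^{-τ B} = [[cos τ, -sin τ],[sin τ, cos τ]]`. -/
def expB (τ : ℂ) : M2 := !![Complex.cos τ, -Complex.sin τ; Complex.sin τ, Complex.cos τ]

/-- Lebesgue measure restricted to `(0,1)`. -/
def μ01 : Measure ℝ := volume.restrict (Set.Ioo 0 1)

/-- Lebesgue measure restricted to `(-1,1)`. -/
def μ11 : Measure ℝ := volume.restrict (Set.Ioo (-1) 1)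

/-- A Dirac-form potential `Q = [[q₁,q₂],[q₂,-q₁]]`. -/
def IsDiracForm (Q : ℝ → M2) : Prop :=
  ∃ q1 q2 : ℝ → ℂ, ∀ x, Q x = !![q1 x, q2 x; q2 x, -q1 x]

/-- A Dirac-form potential with real-valued entries. -/
def IsRealDiracForm (Q : ℝ → M2) : Prop :=
  ∃ q1 q2 : ℝ → ℝ, ∀ x, Q x = !![(q1 x : ℂ), (q2 x : ℂ); (q2 x : ℂ), -(q1 x : ℂ)]

/-- `U` is an absolutely continuous matrix solution of `B U' + Q U = λ U` a.e. on `(0,1)`. -/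
def IsMatSolution (Q : ℝ → M2) (l : ℂ) (U : ℝ → M2) : Prop :=
  ∃ U' : ℝ → M2, IntegrableOn U' (Set.Ioo 0 1) ∧
    (∀ x ∈ Set.Icc (0:ℝ) 1, U x = U 0 + ∫ t in (0:ℝ)..x, U' t) ∧
    (∀ᵐ x ∂μ01, Bmat * U' x + Q x * U x = l • U x)

/-- `u` is an absolutely continuous `ℂ²`-valued solution of `B u' + Q u = λ u` a.e. on `(0,1)`. -/
def IsVecSolution (Q : ℝ → M2) (l : ℂ) (u : ℝ → Fin 2 → ℂ) : Prop :=
  ∃ u' : ℝ → Fin 2 → ℂ, IntegrableOn u' (Set.Ioo 0 1) ∧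
    (∀ x ∈ Set.Icc (0:ℝ) 1, u x = u 0 + ∫ t in (0:ℝ)..x, u' t) ∧
    (∀ᵐ x ∂μ01, Bmat.mulVec (u' x) + (Q x).mulVec (u x) = l • u x)

/-- `λ` is an eigenvalue of the Dirac operator `A_j` (`j = 0` for `A₁`, `j = 1` for `A₂`):
there is a nonzero AC solution with `u₂(0) = 0` and `u_j(1) = 0`. -/
def IsEigenvalue (Q : ℝ → M2) (j : Fin 2) (l : ℝ) : Prop :=
  ∃ u : ℝ → Fin 2 → ℂ, IsVecSolution Q (l : ℂ) u ∧
    (∃ x ∈ Set.Icc (0:ℝ) 1, u x ≠ 0) ∧ u 0 1 = 0 ∧ u 1 j = 0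

/-- `c₀(·,λ) = (cos λx, sin λx)ᵗ`. -/
def c0 (l : ℂ) (x : ℝ) : Fin 2 → ℂ := ![Complex.cos (l * x), Complex.sin (l * x)]

/-- n-th Fourier coefficient `e_n(g) = ∫₀¹ e^{-2πinx} g(x) dx`. -/
def fc (g : ℝ → ℂ) (n : ℤ) : ℂ :=
  ∫ x in (0:ℝ)..1, Complex.exp (-2 * Real.pi * Complex.I * n * x) * g x

/-- The square of the `ℍ = L₂((0,1),ℂ²)` norm of `u`. -/
def hnormSq (u : ℝ → Fin 2 → ℂ) : ℝ :=
  ∫ x in Set.Ioo (0:ℝ) 1, (‖u x 0‖ ^ 2 + ‖u x 1‖ ^ 2)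

/-- The `ℂ²` inner product `⟨v,w⟩ = v₁ w̄₁ + v₂ w̄₂`. -/
def ip2 (v w : Fin 2 → ℂ) : ℂ := v 0 * star (w 0) + v 1 * star (w 1)

/-- The eigenvalue asymptotics `λ_n = π(n+1/2) + e_n(g)` for some `g ∈ L_p(0,1)`. -/
def LamAsymp (p : ℝ≥0∞) (lam : ℤ → ℝ) : Prop :=
  ∃ g : ℝ → ℂ, MemLp g p μ01 ∧
    ∀ n : ℤ, (lam n : ℂ) = Real.pi * (n + 1/2) + fc g n

/-- The eigenvalue asymptotics `μ_n = πn + e_n(g)` for some `g ∈ L_p(0,1)`. -/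
def MuAsymp (p : ℝ≥0∞) (mu : ℤ → ℝ) : Prop :=
  ∃ g : ℝ → ℂ, MemLp g p μ01 ∧
    ∀ n : ℤ, (mu n : ℂ) = Real.pi * n + fc g n

/-- The norming-constant asymptotics `α_n = 1 + e_n(g)` for some `g ∈ L_p(0,1)`. -/
def AlAsymp (p : ℝ≥0∞) (al : ℤ → ℝ) : Prop :=
  ∃ g : ℝ → ℂ, MemLp g p μ01 ∧ ∀ n : ℤ, (al n : ℂ) = 1 + fc g n

/-- Membership in the class `SD_p` of spectral data. -/
def MemSD (p : ℝ≥0∞) (lam mu : ℤ → ℝ) : Prop :=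
  (∀ n : ℤ, lam (n - 1) < mu n ∧ mu n < lam n) ∧ LamAsymp p lam ∧ MuAsymp p mu

/-- Membership in the kernel space `G_p(M₂)`: all slices lie in `L_p` and the slice maps are
continuous from `[0,1]` to `L_p((0,1),M₂)`. -/
def MemGp (p : ℝ≥0∞) (K : ℝ → ℝ → M2) : Prop :=
  (∀ x ∈ Set.Icc (0:ℝ) 1, MemLp (K x) p μ01) ∧
  (∀ t ∈ Set.Icc (0:ℝ) 1, MemLp (fun x => K x t) p μ01) ∧
  (∀ x₀ ∈ Set.Icc (0:ℝ) 1, ∀ ε > (0:ℝ), ∃ δ > (0:ℝ), ∀ x ∈ Set.Icc (0:ℝ) 1,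
    |x - x₀| < δ → eLpNorm (fun t => K x t - K x₀ t) p μ01 < ENNReal.ofReal ε) ∧
  (∀ t₀ ∈ Set.Icc (0:ℝ) 1, ∀ ε > (0:ℝ), ∃ δ > (0:ℝ), ∀ t ∈ Set.Icc (0:ℝ) 1,
    |t - t₀| < δ → eLpNorm (fun x => K x t - K x t₀) p μ01 < ENNReal.ofReal ε)

/-- The norm of the space `G_p(M₂)` (as an extended real number). -/
def gpNorm (p : ℝ≥0∞) (K : ℝ → ℝ → M2) : ℝ≥0∞ :=
  max (⨆ x ∈ Set.Icc (0:ℝ) 1, eLpNorm (K x) p μ01)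
      (⨆ t ∈ Set.Icc (0:ℝ) 1, eLpNorm (fun x => K x t) p μ01)



section Volterra

/-- An exponential weight that makes an integrable kernel small. -/
lemma exists_weight {h : ℝ → ℝ} (hi : Integrable h) (h0 : ∀ s, 0 ≤ h s) :
    ∃ c : ℝ, 0 < c ∧ ∀ x : ℝ, 0 ≤ x →
      ∫ s in (0:ℝ)..x, h s * Real.exp (c * s) ≤ (1 / 2) * Real.exp (c * x) := by
  have hlim : Tendsto (fun n : ℕ => ∫ s, max (h s - n) 0) atTop (nhds (∫ _ : ℝ, (0:ℝ))) := by
    refine tendsto_integral_of_dominated_convergence h (fun n => ?_) hi (fun n => ?_) ?_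
    · exact ((hi.1.aemeasurable.sub_const _).max aemeasurable_const).aestronglyMeasurable
    · refine Eventually.of_forall fun s => ?_
      rw [Real.norm_eq_abs, abs_of_nonneg (le_max_right _ _)]
      exact max_le (by have : (0:ℝ) ≤ n := Nat.cast_nonneg n
                       linarith) (h0 s)
    · refine Eventually.of_forall fun s => ?_
      refine tendsto_const_nhds.congr' ?_
      obtain ⟨N, hN⟩ := exists_nat_ge (h s)
      filter_upwards [eventually_ge_atTop N] with n hn
      have : (N:ℝ) ≤ n := by exact_mod_cast hn
      rw [max_eq_right]; linarith
  simp only [integral_zero] at hlim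
  obtain ⟨n, hn⟩ := (hlim.eventually (gt_mem_nhds (show (0:ℝ) < 1/4 by norm_num))).exists
  have hnn : (0:ℝ) ≤ n := Nat.cast_nonneg n
  refine ⟨4 * n + 1, by linarith, fun x hx => ?_⟩
  set c : ℝ := 4 * n + 1 with hc
  have hcpos : 0 < c := by rw [hc]; linarith
  have hi2 : Integrable (fun s => max (h s - n) 0) := by
    refine hi.mono' ((hi.1.aemeasurable.sub_const _).max aemeasurable_const).aestronglyMeasurable
      (Eventually.of_forall fun s => ?_)
    rw [Real.norm_eq_abs, abs_of_nonneg (le_max_right _ _)]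
    exact max_le (by linarith) (h0 s)
  have hec : Continuous fun s : ℝ => Real.exp (c * s) := by fun_prop
  have e1 : ∫ s in (0:ℝ)..x, h s * Real.exp (c * s) ≤
      ∫ s in (0:ℝ)..x, (n * Real.exp (c * s) + max (h s - n) 0 * Real.exp (c * x)) := by
    refine intervalIntegral.integral_mono_on hx ?_ ?_ fun s hs => ?_
    · exact hi.intervalIntegrable.mul_continuousOn hec.continuousOn
    · exact ((hec.intervalIntegrable _ _).const_mul _).add (hi2.intervalIntegrable.mul_const _)
    · have a1 : h s ≤ n + max (h s - n) 0 := by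
        have := le_max_left (h s - n) 0; linarith
      have a2 : Real.exp (c * s) ≤ Real.exp (c * x) :=
        Real.exp_le_exp.2 (mul_le_mul_of_nonneg_left hs.2 hcpos.le)
      have a3 := (Real.exp_pos (c * s)).le
      have a4 := le_max_right (h s - n) 0
      nlinarith [mul_le_mul_of_nonneg_right a1 a3, mul_le_mul_of_nonneg_left a2 a4]
  rw [intervalIntegral.integral_add ((hec.intervalIntegrable _ _).const_mul _)
    (hi2.intervalIntegrable.mul_const _), intervalIntegral.integral_const_mul,
    intervalIntegral.integral_mul_const] at e1
  have e2 : ∫ s in (0:ℝ)..x, Real.exp (c * s) ≤ Real.exp (c * x) / c := by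
    rw [intervalIntegral.integral_comp_mul_left _ hcpos.ne', integral_exp]
    simp only [mul_zero, Real.exp_zero, smul_eq_mul]
    rw [inv_mul_eq_div]
    gcongr; linarith
  have e3 : ∫ s in (0:ℝ)..x, max (h s - n) 0 ≤ 1 / 4 := by
    rw [intervalIntegral.integral_of_le hx]
    exact (setIntegral_le_integral hi2 (Eventually.of_forall fun s => le_max_right _ _)).trans hn.le
  have e4 : (n:ℝ) * (Real.exp (c * x) / c) ≤ 1 / 4 * Real.exp (c * x) := by
    rw [← mul_div_assoc, div_le_iff₀ hcpos]
    have := (Real.exp_pos (c * x)).le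
    rw [hc] at *
    nlinarith
  have := mul_le_mul_of_nonneg_left e2 hnn
  have := mul_le_mul_of_nonneg_right e3 (Real.exp_pos (c * x)).le
  linarith

/-- Homogeneous Gronwall inequality with an integrable coefficient. -/
lemma gronwall_zero {h D : ℝ → ℝ} (hi : Integrable h) (h0 : ∀ s, 0 ≤ h s)
    (hD : ContinuousOn D (Icc 0 1)) (hD0 : ∀ s, 0 ≤ D s)
    (hle : ∀ x ∈ Icc (0:ℝ) 1, D x ≤ ∫ s in (0:ℝ)..x, h s * D s) :
    ∀ x ∈ Icc (0:ℝ) 1, D x = 0 := by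
  obtain ⟨c, hc, hw⟩ := exists_weight hi h0
  have hec : Continuous fun s : ℝ => Real.exp (c * s) := by fun_prop
  have hcont : ContinuousOn (fun x => D x * Real.exp (-(c * x))) (Icc 0 1) :=
    hD.mul (by fun_prop)
  obtain ⟨x₀, hx₀, hmax⟩ := isCompact_Icc.exists_isMaxOn ⟨0, by simp⟩ hcont
  set M := D x₀ * Real.exp (-(c * x₀)) with hM
  have hDle : ∀ s ∈ Icc (0:ℝ) 1, D s ≤ M * Real.exp (c * s) := by
    intro s hs
    have h1 : D s * Real.exp (-(c * s)) ≤ M := hmax hs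
    have h2 := mul_le_mul_of_nonneg_right h1 (Real.exp_pos (c * s)).le
    rwa [mul_assoc, ← Real.exp_add, neg_add_cancel, Real.exp_zero, mul_one] at h2
  have hM0 : 0 ≤ M := mul_nonneg (hD0 _) (Real.exp_pos _).le
  have key : D x₀ ≤ M * ((1 / 2) * Real.exp (c * x₀)) := by
    refine (hle x₀ hx₀).trans ?_
    refine le_trans ?_ (mul_le_mul_of_nonneg_left (hw x₀ hx₀.1) hM0)
    rw [← intervalIntegral.integral_const_mul]
    have hsub : Icc 0 x₀ ⊆ Icc (0:ℝ) 1 := Icc_subset_Icc_right hx₀.2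
    refine intervalIntegral.integral_mono_on hx₀.1 ?_ ?_ fun s hs => ?_
    · refine hi.intervalIntegrable.mul_continuousOn ?_
      rw [uIcc_of_le hx₀.1]; exact hD.mono hsub
    · exact (hi.intervalIntegrable.mul_continuousOn hec.continuousOn).const_mul _
    · have := mul_le_mul_of_nonneg_left (hDle s (hsub hs)) (h0 s)
      linarith
  have : M ≤ M / 2 := by
    have h2 := mul_le_mul_of_nonneg_right key (Real.exp_pos (-(c * x₀))).le
    rw [← hM] at h2
    have h3 : Real.exp (c * x₀) * Real.exp (-(c * x₀)) = 1 := by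
      rw [← Real.exp_add]; simp
    calc M ≤ _ := h2
      _ = M / 2 * (Real.exp (c * x₀) * Real.exp (-(c * x₀))) := by ring
      _ = M / 2 := by rw [h3, mul_one]
  have hMz : M = 0 := by linarith
  intro x hx
  have := hDle x hx
  rw [hMz, zero_mul] at this
  exact le_antisymm this (hD0 x)

/-- Solvability of a linear Volterra equation in a Banach space. -/
lemma volterra_exists {E : Type*} [NormedAddCommGroup E] [NormedSpace ℝ E] [CompleteSpace E]
    {h : ℝ → ℝ} (hi : Integrable h) (h0 : ∀ s, 0 ≤ h s) (L : ℝ → E → E)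
    (hL0 : ∀ s, L s 0 = 0) (hL : ∀ s e e', ‖L s e - L s e'‖ ≤ h s * ‖e - e'‖)
    (hLm : ∀ f : ℝ → E, Continuous f → AEStronglyMeasurable (fun s => L s (f s)))
    (g : ℝ → E) (hg : Continuous g) :
    ∃ f : ℝ → E, Continuous f ∧ ∀ x ∈ Icc (0:ℝ) 1, f x = g x + ∫ s in (0:ℝ)..x, L s (f s) := by
  obtain ⟨c, hc, hw⟩ := exists_weight hi h0
  have hec : Continuous fun s : ℝ => Real.exp (c * s) := by fun_prop
  have h01 : (0:ℝ) ≤ 1 := zero_le_one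
  -- the rescaled extension
  let ext : C(Icc (0:ℝ) 1, E) → ℝ → E := fun f s => Real.exp (c * s) • IccExtend h01 f s
  have hext : ∀ f, Continuous (ext f) := fun f => hec.smul (f.continuous.Icc_extend')
  have hint : ∀ f : ℝ → E, Continuous f → ∀ a b, IntervalIntegrable (fun s => L s (f s)) volume a b := by
    intro f hf a b
    have : IntervalIntegrable (fun s => h s * ‖f s‖) volume a b :=
      hi.intervalIntegrable.mul_continuousOn hf.norm.continuousOn
    refine this.mono_fun (hLm f hf).restrict (Eventually.of_forall fun s => ?_)
    have := hL s (f s) 0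
    simp only [hL0, sub_zero] at this
    exact this.trans (le_abs_self _)
  let Ψ : C(Icc (0:ℝ) 1, E) → C(Icc (0:ℝ) 1, E) := fun f =>
    ⟨fun x => Real.exp (-(c * x)) • (g x + ∫ s in (0:ℝ)..x, L s (ext f s)), by
      have h1 : Continuous fun x : ℝ => ∫ s in (0:ℝ)..x, L s (ext f s) :=
        intervalIntegral.continuous_primitive (hint _ (hext f)) 0
      have h2 : Continuous fun x : ℝ =>
          Real.exp (-(c * x)) • (g x + ∫ s in (0:ℝ)..x, L s (ext f s)) := by fun_prop
      exact h2.comp continuous_subtype_val⟩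
  have hcontr : ContractingWith (1/2) Ψ := by
    refine ⟨by rw [← NNReal.coe_lt_coe]; norm_num, LipschitzWith.of_dist_le_mul fun f₁ f₂ => ?_⟩
    rw [ContinuousMap.dist_le (by positivity)]
    intro x
    have hx := x.2
    have e1 : Ψ f₁ x - Ψ f₂ x = Real.exp (-(c * x)) •
        ∫ s in (0:ℝ)..x, (L s (ext f₁ s) - L s (ext f₂ s)) := by
      rw [intervalIntegral.integral_sub (hint _ (hext _) _ _) (hint _ (hext _) _ _)]
      simp only [Ψ, ContinuousMap.coe_mk, ← smul_sub]
      congr 1; abel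
    have e2 : ‖∫ s in (0:ℝ)..x, (L s (ext f₁ s) - L s (ext f₂ s))‖ ≤
        ∫ s in (0:ℝ)..x, h s * Real.exp (c * s) * dist f₁ f₂ := by
      refine intervalIntegral.norm_integral_le_of_norm_le hx.1 (Eventually.of_forall fun s hs => ?_) ?_
      · refine (hL _ _ _).trans ?_
        rw [mul_assoc]
        refine mul_le_mul_of_nonneg_left ?_ (h0 s)
        simp only [ext]
        rw [← smul_sub, norm_smul, Real.norm_eq_abs, abs_of_pos (Real.exp_pos _)]
        refine mul_le_mul_of_nonneg_left ?_ (Real.exp_pos _).le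
        simp only [IccExtend, Function.comp, ← dist_eq_norm]
        exact ContinuousMap.dist_apply_le_dist _
      · exact (hi.intervalIntegrable.mul_continuousOn hec.continuousOn).mul_const _
    rw [intervalIntegral.integral_mul_const] at e2
    rw [dist_eq_norm, e1, norm_smul, Real.norm_eq_abs, abs_of_pos (Real.exp_pos _)]
    have e3 := e2.trans (mul_le_mul_of_nonneg_right (hw x hx.1) dist_nonneg)
    calc _ ≤ Real.exp (-(c * x)) * (1 / 2 * Real.exp (c * x) * dist f₁ f₂) :=
          mul_le_mul_of_nonneg_left e3 (Real.exp_pos _).le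
      _ = (Real.exp (-(c * x)) * Real.exp (c * x)) * (1 / 2 * dist f₁ f₂) := by ring
      _ = _ := by rw [← Real.exp_add]; simp
  obtain ⟨f, hf, -⟩ := hcontr.exists_fixedPoint 0 (edist_ne_top _ _)
  refine ⟨ext f, hext f, fun x hx => ?_⟩
  have h1 : Ψ f ⟨x, hx⟩ = f ⟨x, hx⟩ := by rw [hf]
  have h2 : ext f x = Real.exp (c * x) • f ⟨x, hx⟩ := by
    simp only [ext]; rw [IccExtend_of_mem h01 _ hx]
  rw [h2, ← h1]
  simp only [Ψ, ContinuousMap.coe_mk]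
  rw [smul_smul, ← Real.exp_add]; simp

/-- Absolute continuity of complex primitives. -/
lemma ac_primitive {f : ℝ → ℂ} (hf : ∀ a b, IntervalIntegrable f volume a b) :
    AbsolutelyContinuousOnInterval (fun x => ∫ s in (0:ℝ)..x, f s) 0 1 := by
  have hre : IntervalIntegrable (fun s => (f s).re) volume 0 1 := ⟨(hf _ _).1.re, (hf _ _).2.re⟩
  have him : IntervalIntegrable (fun s => (f s).im) volume 0 1 := ⟨(hf _ _).1.im, (hf _ _).2.im⟩
  have a1 := hre.absolutelyContinuousOnInterval_intervalIntegral (c := 0) (by simp)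
  have a2 := him.absolutelyContinuousOnInterval_intervalIntegral (c := 0) (by simp)
  have c1 : ∀ z : ℂ, AbsolutelyContinuousOnInterval (fun _ : ℝ => z) 0 1 := fun z =>
    ContDiffOn.absolutelyContinuousOnInterval contDiffOn_const
  have := (a1.smul (c1 1)).add (a2.smul (c1 Complex.I))
  have h2 : (fun x => ∫ s in (0:ℝ)..x, f s) =
      (((fun x => ∫ s in (0:ℝ)..x, (f s).re) • (fun _ : ℝ => (1:ℂ))) +
      ((fun x => ∫ s in (0:ℝ)..x, (f s).im) • (fun _ : ℝ => Complex.I))) := by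
    funext x
    simp only [Pi.add_apply, Pi.smul_apply']
    have r1 := Complex.reCLM.intervalIntegral_comp_comm (hf 0 x)
    have r2 := Complex.imCLM.intervalIntegral_comp_comm (hf 0 x)
    simp only [Complex.reCLM_apply, Complex.imCLM_apply] at r1 r2
    rw [r1, r2]
    simp [Complex.re_add_im]
  rw [h2]
  exact this

/-- Product rule for an exponential times an absolutely continuous function. -/
lemma exp_mul_ac {w w' : ℝ → ℂ} (m : ℂ) (hw' : Integrable w')
    (hw : ∀ x ∈ Icc (0:ℝ) 1, w x = w 0 + ∫ s in (0:ℝ)..x, w' s) :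
    ∀ x ∈ Icc (0:ℝ) 1, Complex.exp (m * x) * w x =
      w 0 + ∫ s in (0:ℝ)..x, Complex.exp (m * s) * (w' s + m * w s) := by
  have hi : ∀ a b, IntervalIntegrable w' volume a b := fun a b => hw'.intervalIntegrable
  set W : ℝ → ℂ := fun x => w 0 + ∫ s in (0:ℝ)..x, w' s with hW
  have hWc : Continuous W := continuous_const.add (intervalIntegral.continuous_primitive hi 0)
  have hexp : Continuous fun s : ℝ => Complex.exp (m * s) := by fun_prop
  have hi2 : ∀ a b, IntervalIntegrable (fun s : ℝ => Complex.exp (m * s) * (w' s + m * W s))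
      volume a b := fun a b =>
    ((hi a b).add ((continuous_const.mul hWc).intervalIntegrable a b)).continuousOn_mul
      hexp.continuousOn
  have c1 : ∀ z : ℂ, AbsolutelyContinuousOnInterval (fun _ : ℝ => z) 0 1 := fun z =>
    ContDiffOn.absolutelyContinuousOnInterval contDiffOn_const
  have hacexp : AbsolutelyContinuousOnInterval (fun s : ℝ => Complex.exp (m * s)) 0 1 := by
    apply ContDiffOn.absolutelyContinuousOnInterval
    apply ContDiff.contDiffOn
    exact (contDiff_const.mul Complex.ofRealCLM.contDiff).cexp
  have hF := (hacexp.smul ((c1 (w 0)).add (ac_primitive hi))).sub (ac_primitive hi2)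
  have hder : ∀ᵐ x : ℝ, x ∈ uIcc (0:ℝ) 1 → HasDerivAt
      ((fun s : ℝ => Complex.exp (m * s)) • ((fun _ : ℝ => w 0) + fun x => ∫ s in (0:ℝ)..x, w' s) -
        fun x => ∫ s in (0:ℝ)..x, Complex.exp (m * s) * (w' s + m * W s)) 0 x := by
    filter_upwards [(hi 0 1).ae_hasDerivAt_integral, (hi2 0 1).ae_hasDerivAt_integral]
      with x h1 h2 hx
    have d1 := (h1 hx 0 (by simp)).const_add (w 0)
    have d2 := h2 hx 0 (by simp)
    have d3 : HasDerivAt (fun s : ℝ => Complex.exp (m * s)) (Complex.exp (m * x) * m) x := by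
      have : HasDerivAt (fun s : ℝ => m * (s:ℂ)) (m * 1) x :=
        (Complex.ofRealCLM.hasDerivAt (x := x)).const_mul m
      simpa using this.cexp
    have d4 := (d3.mul d1).sub d2
    refine d4.congr_deriv ?_
    rw [show W x = w 0 + ∫ s in (0:ℝ)..x, w' s from rfl]
    ring
  obtain ⟨C, hC⟩ := hF.const_of_ae_hasDerivAt_zero hder
  rw [uIcc_of_le zero_le_one] at hC
  have hC0 := hC 0 (by simp)
  simp at hC0
  intro x hx
  have hCx := hC x hx
  simp only [Pi.sub_apply, smul_eq_mul, Pi.mul_apply, Pi.add_apply, ← hC0] at hCx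
  rw [hw x hx, sub_eq_iff_eq_add.1 hCx]
  congr 1
  refine intervalIntegral.integral_congr fun s hs => ?_
  rw [uIcc_of_le hx.1] at hs
  rw [hw s ⟨hs.1, hs.2.trans hx.2⟩]

end Volterra

section LpTools

open Topology

/-- `L_p(ℝ)`. -/
abbrev XLp (p : ℝ≥0∞) := Lp ℂ p (volume : Measure ℝ)

variable {p : ℝ≥0∞} [hp1 : Fact (1 ≤ p)]

/-- Cut-off to the interval between `0` and `y`, as a function. -/
def cutFun (p : ℝ≥0∞) [Fact (1 ≤ p)] (y : ℝ) (f : XLp p) : XLp p :=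
  MemLp.toLp ((uIoc 0 y).indicator f)
    ((Lp.memLp f).indicator (measurableSet_uIoc (a := (0:ℝ)) (b := y)))

lemma cutFun_coeFn (y : ℝ) (f : XLp p) : cutFun p y f =ᵐ[volume] (uIoc 0 y).indicator f :=
  MemLp.coeFn_toLp _

lemma cutFun_add (y : ℝ) (f g : XLp p) : cutFun p y (f + g) = cutFun p y f + cutFun p y g := by
  apply Lp.ext
  filter_upwards [cutFun_coeFn y f, cutFun_coeFn y g, cutFun_coeFn y (f + g), Lp.coeFn_add f g,
    Lp.coeFn_add (cutFun p y f) (cutFun p y g)] with t h1 h2 h3 h4 h5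
  rw [h5, Pi.add_apply, h1, h2, h3]
  by_cases ht : t ∈ uIoc 0 y
  · rw [indicator_of_mem ht, indicator_of_mem ht, indicator_of_mem ht, h4, Pi.add_apply]
  · rw [indicator_of_notMem ht, indicator_of_notMem ht, indicator_of_notMem ht, add_zero]

lemma cutFun_smul (y : ℝ) (c : ℂ) (f : XLp p) : cutFun p y (c • f) = c • cutFun p y f := by
  apply Lp.ext
  filter_upwards [cutFun_coeFn y f, cutFun_coeFn y (c • f), Lp.coeFn_smul c f,
    Lp.coeFn_smul c (cutFun p y f)] with t h1 h3 h4 h5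
  rw [h5, Pi.smul_apply, h1, h3]
  by_cases ht : t ∈ uIoc 0 y
  · rw [indicator_of_mem ht, indicator_of_mem ht, h4, Pi.smul_apply]
  · rw [indicator_of_notMem ht, indicator_of_notMem ht, smul_zero]

lemma cutFun_norm_le (y : ℝ) (f : XLp p) : ‖cutFun p y f‖ ≤ ‖f‖ := by
  rw [Lp.norm_def, Lp.norm_def, eLpNorm_congr_ae (cutFun_coeFn y f)]
  exact ENNReal.toReal_mono (Lp.eLpNorm_ne_top f) (eLpNorm_indicator_le _)

/-- Cut-off to the interval between `0` and `y`. -/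
def cutL (p : ℝ≥0∞) [Fact (1 ≤ p)] (y : ℝ) : XLp p →L[ℂ] XLp p :=
  LinearMap.mkContinuous
    { toFun := cutFun p y
      map_add' := cutFun_add y
      map_smul' := cutFun_smul y } 1 (fun f => by
      rw [one_mul]; exact cutFun_norm_le y f)

lemma cutL_coeFn (y : ℝ) (f : XLp p) : cutL p y f =ᵐ[volume] (uIoc 0 y).indicator f :=
  cutFun_coeFn y f

lemma cutL_norm_le (y : ℝ) (f : XLp p) : ‖cutL p y f‖ ≤ ‖f‖ := cutFun_norm_le y f

lemma cutL_diff (y z : ℝ) (f : XLp p) :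
    ‖cutL p y f - cutL p z f‖ ≤ (eLpNorm ((uIoc y z).indicator f) p volume).toReal := by
  rw [Lp.norm_def]
  refine ENNReal.toReal_mono ((Lp.memLp f).indicator measurableSet_uIoc).2.ne
    (eLpNorm_mono_ae ?_)
  filter_upwards [Lp.coeFn_sub (cutL p y f) (cutL p z f), cutL_coeFn y f, cutL_coeFn z f]
    with t h1 h2 h3
  rw [h1, Pi.sub_apply, h2, h3]
  by_cases hy : t ∈ uIoc 0 y <;> by_cases hz : t ∈ uIoc 0 z <;> by_cases hyz : t ∈ uIoc y z <;>
    simp [hy, hz, hyz] <;> exfalso <;> simp only [mem_uIoc] at hy hz hyz <;> grind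

lemma cutL_continuous (hp' : p ≠ ∞) : Continuous fun q : ℝ × XLp p => cutL p q.1 q.2 := by
  have h1 : ∀ f : XLp p, Continuous fun y : ℝ => cutL p y f := by
    intro f
    rw [Metric.continuous_iff]
    intro y ε hε
    obtain ⟨δ, hδ, hh⟩ := (Lp.memLp f).eLpNorm_indicator_le hp1.out hp' (half_pos hε)
    refine ⟨δ, hδ, fun z hz => ?_⟩
    rw [dist_eq_norm]
    refine lt_of_le_of_lt (cutL_diff z y f) ?_
    have := hh (uIoc z y) measurableSet_uIoc (by
      rw [Real.volume_uIoc]; apply ENNReal.ofReal_le_ofReal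
      rw [abs_sub_comm]; exact hz.le)
    refine lt_of_le_of_lt (ENNReal.toReal_le_of_le_ofReal (half_pos hε).le this) (by linarith)
  rw [Metric.continuous_iff]
  rintro ⟨y, f⟩ ε hε
  obtain ⟨δ, hδ, hh⟩ := Metric.continuous_iff.1 (h1 f) y (ε / 2) (half_pos hε)
  refine ⟨min δ (ε / 2), lt_min hδ (half_pos hε), ?_⟩
  rintro ⟨z, g⟩ hzg
  rw [Prod.dist_eq, max_lt_iff] at hzg
  have e1 := hh z (hzg.1.trans_le (min_le_left _ _))
  have e2 : dist (cutL p z g) (cutL p z f) ≤ dist g f := by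
    rw [dist_eq_norm, dist_eq_norm, ← map_sub]; exact cutL_norm_le _ _
  have e3 : dist g f < ε / 2 := hzg.2.trans_le (min_le_right _ _)
  calc dist (cutL p z g) (cutL p y f) ≤ _ := dist_triangle _ (cutL p z f) _
    _ < ε := by linarith

/-- Translation `f ↦ f (· - y)`. -/
def shiftL (p : ℝ≥0∞) [Fact (1 ≤ p)] (y : ℝ) (f : XLp p) : XLp p :=
  DomAddAct.mk (-y) +ᵥ f

lemma shiftL_coeFn (y : ℝ) (f : XLp p) : shiftL p y f =ᵐ[volume] fun t => f (t - y) := by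
  have := DomAddAct.vadd_Lp_ae_eq (DomAddAct.mk (-y)) f
  refine this.trans (Eventually.of_forall fun t => ?_)
  simp only [Equiv.symm_apply_apply, vadd_eq_add]
  congr 1; ring

lemma shiftL_norm (y : ℝ) (f : XLp p) : ‖shiftL p y f‖ = ‖f‖ := DomAddAct.norm_vadd_Lp _ _

lemma shiftL_sub (y : ℝ) (f g : XLp p) : shiftL p y (f - g) = shiftL p y f - shiftL p y g :=
  DomAddAct.vadd_Lp_sub _ _ _

lemma shiftL_continuous (hp' : p ≠ ∞) : Continuous fun q : ℝ × XLp p => shiftL p q.1 q.2 := by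
  have : Fact (p ≠ ∞) := ⟨hp'⟩
  have h2 : Continuous fun q : ℝ × XLp p => (DomAddAct.mk (-q.1) : ℝᵈᵃᵃ) :=
    DomAddAct.continuous_mk.comp continuous_fst.neg
  exact Continuous.vadd h2 continuous_snd

/-- The operator `T_y P_{-y}`. -/
def opA (p : ℝ≥0∞) [Fact (1 ≤ p)] (y : ℝ) (f : XLp p) : XLp p := shiftL p y (cutL p (-y) f)

lemma opA_coeFn (y : ℝ) (f : XLp p) :
    opA p y f =ᵐ[volume] fun t => (uIoc 0 (-y)).indicator f (t - y) := by
  refine (shiftL_coeFn _ _).trans ?_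
  exact (measurePreserving_sub_right volume y).quasiMeasurePreserving.ae_eq (cutL_coeFn (-y) f)

lemma opA_norm_sub (y : ℝ) (f g : XLp p) : ‖opA p y f - opA p y g‖ ≤ ‖f - g‖ := by
  rw [opA, opA, ← shiftL_sub, shiftL_norm, ← map_sub]; exact cutL_norm_le _ _

lemma opA_zero (y : ℝ) : opA p y 0 = 0 := by
  rw [opA, map_zero]
  have := shiftL_sub y (0 : XLp p) 0
  simpa using this

lemma opA_continuous (hp' : p ≠ ∞) : Continuous fun q : ℝ × XLp p => opA p q.1 q.2 := by
  have h1 := shiftL_continuous (p := p) hp'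
  have h2 := cutL_continuous (p := p) hp'
  exact h1.comp (continuous_fst.prodMk (h2.comp (continuous_fst.neg.prodMk continuous_snd)))

lemma ae_ne_volume (a : ℝ) : ∀ᵐ t : ℝ, t ≠ a := by
  simp [ae_iff]

lemma cutL_opA {y z : ℝ} (hyz : uIoc 0 z ⊆ uIoc 0 y) (f : XLp p) :
    cutL p y (opA p z f) = opA p z f := by
  apply Lp.ext
  filter_upwards [cutL_coeFn y (opA p z f), opA_coeFn z f, ae_ne_volume 0, ae_ne_volume z]
    with t h1 h2 h3 h4
  rw [h1]
  by_cases ht : t ∈ uIoc 0 y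
  · rw [indicator_of_mem ht]
  · rw [indicator_of_notMem ht, h2, indicator_of_notMem]
    intro h5
    apply ht; apply hyz
    simp only [mem_uIoc] at h5 ⊢
    grind

lemma cutL_cutL (y : ℝ) (f : XLp p) : cutL p y (cutL p y f) = cutL p y f := by
  apply Lp.ext
  filter_upwards [cutL_coeFn y (cutL p y f), cutL_coeFn y f] with t h1 h2
  rw [h1]
  by_cases ht : t ∈ uIoc 0 y
  · rw [indicator_of_mem ht]
  · rw [indicator_of_notMem ht, h2, indicator_of_notMem ht]

/-- The Fourier functional on `(-2,2]`. -/
lemma exists_fourier (p : ℝ≥0∞) [hp1 : Fact (1 ≤ p)] (l : ℂ) : ∃ Φ : XLp p →L[ℂ] ℂ, ∀ f : XLp p,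
    Φ f = ∫ t in Ioc (-2:ℝ) 2, Complex.exp (Complex.I * l * t) * f t := by
  have hexp : Continuous fun t : ℝ => Complex.exp (Complex.I * l * t) := by fun_prop
  have hint : ∀ f : XLp p, IntegrableOn f (Ioc (-2:ℝ) 2) := fun f =>
    ((Lp.memLp f).restrict _).integrable hp1.out
  obtain ⟨M, hM⟩ := (isCompact_Icc (a := (-2:ℝ)) (b := 2)).exists_bound_of_continuousOn
    hexp.continuousOn
  have hint2 : ∀ f : XLp p,
      IntegrableOn (fun t : ℝ => Complex.exp (Complex.I * l * t) * f t) (Ioc (-2:ℝ) 2) := by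
    intro f
    refine Integrable.bdd_mul (c := M) (hint f) hexp.aestronglyMeasurable ?_
    exact (ae_restrict_mem measurableSet_Ioc).mono fun t ht => hM t (Ioc_subset_Icc_self ht)
  have hM0 : 0 ≤ M := (norm_nonneg _).trans (hM 0 (by constructor <;> norm_num))
  let C : ℝ≥0∞ := (volume.restrict (Ioc (-2:ℝ) 2)) univ ^ (1 / (1:ℝ≥0∞).toReal - 1 / p.toReal)
  have hC : C ≠ ∞ := by
    refine ENNReal.rpow_ne_top_of_nonneg ?_ (by simp)
    rw [sub_nonneg]
    by_cases hp' : p = ∞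
    · simp [hp']
    · have : 1 ≤ p.toReal := by
        rw [← ENNReal.toReal_one]; exact ENNReal.toReal_mono hp' hp1.out
      simp only [ENNReal.toReal_one]
      exact one_div_le_one_div_of_le one_pos this
  refine ⟨LinearMap.mkContinuous
    { toFun := fun f => ∫ t in Ioc (-2:ℝ) 2, Complex.exp (Complex.I * l * t) * f t
      map_add' := fun f g => by
        rw [← integral_add (hint2 f) (hint2 g)]
        refine integral_congr_ae (ae_restrict_of_ae ?_)
        filter_upwards [Lp.coeFn_add f g] with t ht
        rw [ht, Pi.add_apply, mul_add]
      map_smul' := fun c f => by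
        rw [RingHom.id_apply, smul_eq_mul, ← integral_const_mul]
        refine integral_congr_ae (ae_restrict_of_ae ?_)
        filter_upwards [Lp.coeFn_smul c f] with t ht
        rw [ht, Pi.smul_apply, smul_eq_mul]; ring } (M * C.toReal) (fun f => ?_), fun f => rfl⟩
  simp only [LinearMap.coe_mk, AddHom.coe_mk]
  have e1 : ‖∫ t in Ioc (-2:ℝ) 2, Complex.exp (Complex.I * l * t) * f t‖ ≤
      ∫ t in Ioc (-2:ℝ) 2, M * ‖f t‖ := by
    refine norm_integral_le_of_norm_le ((hint f).norm.const_mul M) ?_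
    refine (ae_restrict_mem measurableSet_Ioc).mono fun t ht => ?_
    rw [norm_mul]
    exact mul_le_mul_of_nonneg_right (hM t (Ioc_subset_Icc_self ht)) (norm_nonneg _)
  refine e1.trans ?_
  rw [integral_const_mul, mul_assoc]
  refine mul_le_mul_of_nonneg_left ?_ hM0
  rw [integral_norm_eq_lintegral_enorm (hint f).1, ← eLpNorm_one_eq_lintegral_enorm]
  have e2 := eLpNorm_le_eLpNorm_mul_rpow_measure_univ (μ := volume.restrict (Ioc (-2:ℝ) 2))
    hp1.out (hint f).1
  have e3 : eLpNorm f 1 (volume.restrict (Ioc (-2:ℝ) 2)) ≤ eLpNorm f p volume * C :=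
    e2.trans (mul_le_mul_left (eLpNorm_mono_measure _ Measure.restrict_le_self) _)
  have e4 := ENNReal.toReal_mono (ENNReal.mul_ne_top (Lp.eLpNorm_ne_top f) hC) e3
  rw [ENNReal.toReal_mul] at e4
  rw [Lp.norm_def, mul_comm]
  exact e4

end LpTools

section Rep

variable {p : ℝ≥0∞} [hp1 : Fact (1 ≤ p)]

/-- The Fourier functional. -/
def fourL (p : ℝ≥0∞) [Fact (1 ≤ p)] (l : ℂ) : XLp p →L[ℂ] ℂ := (exists_fourier p l).choose

lemma fourL_apply (l : ℂ) (f : XLp p) :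
    fourL p l f = ∫ t in Ioc (-2:ℝ) 2, Complex.exp (Complex.I * l * t) * f t :=
  (exists_fourier p l).choose_spec f

lemma fourL_congr (l : ℂ) {f : XLp p} {g : ℝ → ℂ} (h : f =ᵐ[volume] g)
    (hg : ∀ t, t ∉ Ioc (-2:ℝ) 2 → g t = 0) :
    fourL p l f = ∫ t : ℝ, Complex.exp (Complex.I * l * t) * g t := by
  rw [fourL_apply, ← setIntegral_eq_integral_of_forall_compl_eq_zero (s := Ioc (-2:ℝ) 2)
    (f := fun t : ℝ => Complex.exp (Complex.I * l * t) * g t)]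
  · refine integral_congr_ae (ae_restrict_of_ae ?_)
    filter_upwards [h] with t ht
    rw [ht]
  · intro t ht
    rw [hg t ht, mul_zero]

lemma fourL_opA (l : ℂ) {y : ℝ} (hy : |y| ≤ 2) (f : XLp p) :
    fourL p l (opA p y f) = Complex.exp (Complex.I * l * y) * fourL p l (cutL p (-y) f) := by
  rw [abs_le] at hy
  rw [fourL_congr l (opA_coeFn y f), fourL_congr l (cutL_coeFn (-y) f), ← integral_const_mul]
  · rw [← integral_sub_right_eq_self (fun t : ℝ => Complex.exp (Complex.I * l * y) *
      (Complex.exp (Complex.I * l * t) * (uIoc 0 (-y)).indicator f t)) y]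
    congr 1
    funext t
    rw [← mul_assoc, ← Complex.exp_add]
    congr 2
    push_cast; ring
  · intro t ht
    rw [indicator_of_notMem]
    intro h5
    simp only [mem_uIoc, mem_Ioc] at h5 ht
    grind
  · intro t ht
    rw [indicator_of_notMem]
    intro h5
    simp only [mem_uIoc, mem_Ioc] at h5 ht
    grind

lemma fourL_gamma (l : ℂ) {σ : ℝ} (hσ : σ = 1 ∨ σ = -1) {a : ℝ → ℂ} {γ : XLp p}
    (hγ : γ =ᵐ[volume] fun t => (1 / 2 : ℂ) * a (σ * t / 2)) {x : ℝ} (hx : x ∈ Icc (0:ℝ) 1) :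
    fourL p l (cutL p (2 * σ * x) γ) =
      ∫ s in (0:ℝ)..x, a s * Complex.exp (Complex.I * l * (2 * σ * s : ℝ)) := by
  have hσ2 : σ * σ = 1 := by rcases hσ with rfl | rfl <;> norm_num
  have hσ0 : (2 * σ) ≠ 0 := by rcases hσ with rfl | rfl <;> norm_num
  have hcoe : cutL p (2 * σ * x) γ =ᵐ[volume]
      (uIoc 0 (2 * σ * x)).indicator fun t => (1 / 2 : ℂ) * a (σ * t / 2) := by
    filter_upwards [cutL_coeFn (2 * σ * x) γ, hγ] with t h1 h2
    rw [h1]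
    by_cases ht : t ∈ uIoc 0 (2 * σ * x)
    · rw [indicator_of_mem ht, indicator_of_mem ht, h2]
    · rw [indicator_of_notMem ht, indicator_of_notMem ht]
  rw [fourL_congr l hcoe]
  swap
  · intro t ht
    rw [indicator_of_notMem]
    intro h5
    simp only [mem_uIoc, mem_Ioc, mem_Icc] at h5 ht hx
    rcases hσ with rfl | rfl <;> grind
  set F : ℝ → ℂ := fun t => Complex.exp (Complex.I * l * t) * ((1 / 2 : ℂ) * a (σ * t / 2)) with hF
  have e1 : ∫ t : ℝ, Complex.exp (Complex.I * l * t) *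
      (uIoc 0 (2 * σ * x)).indicator (fun t => (1 / 2 : ℂ) * a (σ * t / 2)) t =
      ∫ t in uIoc 0 (2 * σ * x), F t := by
    rw [← integral_indicator measurableSet_uIoc]
    congr 1
    funext t
    by_cases ht : t ∈ uIoc 0 (2 * σ * x)
    · rw [indicator_of_mem ht, indicator_of_mem ht]
    · rw [indicator_of_notMem ht, indicator_of_notMem ht, mul_zero]
  have e2 : ∫ t in uIoc 0 (2 * σ * x), F t = (σ : ℂ) * ∫ t in (0:ℝ)..(2 * σ * x), F t := by
    rcases hσ with rfl | rfl
    · rw [uIoc_of_le (by linarith [hx.1]), intervalIntegral.integral_of_le (by linarith [hx.1])]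
      simp
    · rw [uIoc_of_ge (by linarith [hx.1]), intervalIntegral.integral_of_ge (by linarith [hx.1])]
      simp
  have e3 := intervalIntegral.integral_comp_mul_left (a := 0) (b := x) F hσ0
  rw [mul_zero] at e3
  have e4 : ∫ t in (0:ℝ)..(2 * σ * x), F t = (2 * σ) • ∫ s in (0:ℝ)..x, F (2 * σ * s) := by
    rw [e3, smul_smul, mul_inv_cancel₀ hσ0, one_smul]
  rw [e1, e2, e4, Complex.real_smul, ← mul_assoc, ← intervalIntegral.integral_const_mul]
  refine intervalIntegral.integral_congr fun s _ => ?_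
  have h1 : (σ:ℂ) * ((2 * σ : ℝ) : ℂ) = 2 := by
    rw [← Complex.ofReal_mul, show σ * (2 * σ) = 2 * (σ * σ) by ring, hσ2]; norm_num
  have h2 : σ * (2 * σ * s) / 2 = s := by
    rw [show σ * (2 * σ * s) / 2 = (σ * σ) * s by ring, hσ2, one_mul]
  simp only [hF]
  rw [h1, h2]
  ring

lemma memLp_scale {a : ℝ → ℂ} (ha : MemLp a p volume) {σ : ℝ} (hσ : σ = 1 ∨ σ = -1) :
    MemLp (fun t => (1 / 2 : ℂ) * a (σ * t / 2)) p volume := by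
  refine MemLp.const_mul ?_ _
  have hσ0 : (σ / 2) ≠ 0 := by rcases hσ with rfl | rfl <;> norm_num
  have hm := Real.map_volume_mul_left hσ0
  have h1 : MemLp a p (Measure.map (fun t => σ / 2 * t) volume) := by
    rw [hm]; exact ha.smul_measure ENNReal.ofReal_ne_top
  have h2 := h1.comp_of_map (by fun_prop)
  have h3 : (fun t : ℝ => a (σ * t / 2)) = a ∘ fun t => σ / 2 * t := by
    funext t
    simp only [Function.comp]
    congr 1; ring
  rw [h3]; exact h2

lemma opA_cont (hp' : p ≠ ∞) (c : ℝ) {f : ℝ → XLp p} (hf : Continuous f) :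
    Continuous fun s : ℝ => opA p (c * s) (f s) := by
  have h1 := opA_continuous (p := p) hp'
  have h2 : Continuous fun s : ℝ => ((c * s, f s) : ℝ × XLp p) :=
    (continuous_const.mul continuous_id).prodMk hf
  exact Continuous.comp (g := fun q : ℝ × XLp p => opA p q.1 q.2)
    (f := fun s : ℝ => ((c * s, f s) : ℝ × XLp p)) h1 h2

lemma cutL_cont (hp' : p ≠ ∞) (c : ℝ) (γ : XLp p) :
    Continuous fun s : ℝ => cutL p (c * s) γ := by
  have h1 := cutL_continuous (p := p) hp'
  have h2 : Continuous fun s : ℝ => ((c * s, γ) : ℝ × XLp p) :=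
    (continuous_const.mul continuous_id).prodMk continuous_const
  exact h1.comp h2

lemma intble_opA (hp' : p ≠ ∞) {a : ℝ → ℂ} (ha : Integrable a) (c : ℝ)
    {κ' : ℝ → XLp p} (hκ' : Continuous κ') (x y : ℝ) :
    IntervalIntegrable (fun s => a s • opA p (c * s) (κ' s)) volume x y := by
  have hc : Continuous fun s => opA p (c * s) (κ' s) := opA_cont hp' c hκ'
  exact (ha.intervalIntegrable (a := x) (b := y)).smul_continuousOn hc.continuousOn

lemma rep_support (hp' : p ≠ ∞) {a : ℝ → ℂ} (ha : Integrable a) {σ : ℝ} (hσ : σ = 1 ∨ σ = -1)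
    {γ : XLp p} {κ κ' : ℝ → XLp p} (hκ' : Continuous κ')
    (heq : ∀ x ∈ Icc (0:ℝ) 1, κ x = cutL p (2 * σ * x) γ +
      ∫ s in (0:ℝ)..x, a s • opA p (2 * σ * s) (κ' s)) :
    ∀ x ∈ Icc (0:ℝ) 1, cutL p (2 * σ * x) (κ x) = κ x := by
  intro x hx
  rw [heq x hx, map_add, cutL_cutL,
    ← (cutL p (2 * σ * x)).intervalIntegral_comp_comm (intble_opA hp' ha _ hκ' 0 x)]
  congr 1
  refine intervalIntegral.integral_congr fun s hs => ?_
  rw [uIcc_of_le hx.1] at hs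
  rw [map_smul, cutL_opA]
  intro t ht
  simp only [mem_uIoc, mem_Icc] at ht hs ⊢
  rcases hσ with rfl | rfl <;> grind

lemma rep_fourier (hp' : p ≠ ∞) {a : ℝ → ℂ} (ha : Integrable a) {σ : ℝ} (hσ : σ = 1 ∨ σ = -1)
    {γ : XLp p} (hγ : γ =ᵐ[volume] fun t => (1 / 2 : ℂ) * a (σ * t / 2))
    {κ κ' : ℝ → XLp p} (hκ' : Continuous κ')
    (heq : ∀ x ∈ Icc (0:ℝ) 1, κ x = cutL p (2 * σ * x) γ +
      ∫ s in (0:ℝ)..x, a s • opA p (2 * σ * s) (κ' s))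
    (hsupp : ∀ x ∈ Icc (0:ℝ) 1, cutL p (-(2 * σ * x)) (κ' x) = κ' x) (l : ℂ) :
    ∀ x ∈ Icc (0:ℝ) 1, fourL p l (κ x) =
      ∫ s in (0:ℝ)..x, a s * Complex.exp (Complex.I * l * (2 * σ * s : ℝ)) *
        (1 + fourL p l (κ' s)) := by
  intro x hx
  have hexp : Continuous fun s : ℝ => Complex.exp (Complex.I * l * (2 * σ * s : ℝ)) := by fun_prop
  have hi1 : IntervalIntegrable (fun s : ℝ => a s * Complex.exp (Complex.I * l * (2 * σ * s : ℝ)))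
      volume 0 x := ha.intervalIntegrable.mul_continuousOn hexp.continuousOn
  have hi2 : IntervalIntegrable (fun s : ℝ => a s * Complex.exp (Complex.I * l * (2 * σ * s : ℝ))
      * fourL p l (κ' s)) volume 0 x :=
    hi1.mul_continuousOn ((fourL p l).continuous.comp hκ').continuousOn
  rw [heq x hx, map_add, fourL_gamma l hσ hγ hx,
    ← (fourL p l).intervalIntegral_comp_comm (intble_opA hp' ha _ hκ' 0 x)]
  simp_rw [mul_add, mul_one]
  rw [intervalIntegral.integral_add hi1 hi2]
  congr 1
  refine intervalIntegral.integral_congr fun s hs => ?_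
  rw [uIcc_of_le hx.1] at hs
  have hs1 : s ∈ Icc (0:ℝ) 1 := ⟨hs.1, hs.2.trans hx.2⟩
  rw [map_smul, fourL_opA, hsupp s hs1, smul_eq_mul, ← mul_assoc]
  have := hs1.1
  have := hs1.2
  rw [abs_le]
  rcases hσ with rfl | rfl <;> constructor <;> linarith

/-- Solution of the integral equations for the kernels. -/
lemma exists_volterra_pair (hp' : p ≠ ∞) {a b : ℝ → ℂ} (ha : Integrable a) (hb : Integrable b)
    (γa γb : XLp p) :
    ∃ κ₁ κ₂ : ℝ → XLp p, Continuous κ₁ ∧ Continuous κ₂ ∧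
      (∀ x ∈ Icc (0:ℝ) 1, κ₁ x = cutL p (2 * (-1) * x) γa +
        ∫ s in (0:ℝ)..x, a s • opA p (2 * (-1) * s) (κ₂ s)) ∧
      (∀ x ∈ Icc (0:ℝ) 1, κ₂ x = cutL p (2 * 1 * x) γb +
        ∫ s in (0:ℝ)..x, b s • opA p (2 * 1 * s) (κ₁ s)) := by
  have h0 : ∀ s, 0 ≤ ‖a s‖ + ‖b s‖ := fun s => by positivity
  have hcut := cutL_cont (p := p) hp'
  have hop := fun (c : ℝ) (f : ℝ → XLp p) (hf : Continuous f) => opA_cont hp' c hf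
  obtain ⟨κ, hκ, hκeq⟩ := volterra_exists (E := XLp p × XLp p) (h := fun s => ‖a s‖ + ‖b s‖)
    (ha.norm.add hb.norm) h0
    (fun s e => (a s • opA p (2 * (-1) * s) e.2, b s • opA p (2 * 1 * s) e.1))
    (fun s => by simp [opA_zero])
    (fun s e e' => by
      rw [Prod.norm_def]
      refine max_le ?_ ?_
      · simp only [Prod.fst_sub]
        rw [← smul_sub, norm_smul]
        refine mul_le_mul (by linarith [norm_nonneg (b s)])
          ((opA_norm_sub _ _ _).trans (norm_snd_le (e - e'))) (norm_nonneg _) (h0 s)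
      · simp only [Prod.snd_sub]
        rw [← smul_sub, norm_smul]
        refine mul_le_mul (by linarith [norm_nonneg (a s)])
          ((opA_norm_sub _ _ _).trans (norm_fst_le (e - e'))) (norm_nonneg _) (h0 s))
    (fun f hf => by
      refine AEStronglyMeasurable.prodMk ?_ ?_
      · exact ha.1.smul (hop _ _ hf.snd).aestronglyMeasurable
      · exact hb.1.smul (hop _ _ hf.fst).aestronglyMeasurable)
    (fun x => (cutL p (2 * (-1) * x) γa, cutL p (2 * 1 * x) γb))
    ((hcut _ _).prodMk (hcut _ _))
  have hi1 := fun x => intble_opA hp' ha (2 * (-1)) hκ.snd 0 x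
  have hi2 := fun x => intble_opA hp' hb (2 * 1) hκ.fst 0 x
  have hi : ∀ x, IntervalIntegrable (fun s => (a s • opA p (2 * (-1) * s) (κ s).2,
      b s • opA p (2 * 1 * s) (κ s).1)) volume 0 x := fun x =>
    ⟨(hi1 x).1.prodMk (hi2 x).1, (hi1 x).2.prodMk (hi2 x).2⟩
  have heq1 : ∀ x ∈ Icc (0:ℝ) 1, (κ x).1 = cutL p (2 * (-1) * x) γa +
      ∫ s in (0:ℝ)..x, a s • opA p (2 * (-1) * s) (κ s).2 := by
    intro x hx
    have e := (ContinuousLinearMap.fst ℝ (XLp p) (XLp p)).intervalIntegral_comp_comm (hi x)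
    simp only [ContinuousLinearMap.coe_fst'] at e
    rw [e]
    conv_lhs => rw [hκeq x hx]
    rfl
  have heq2 : ∀ x ∈ Icc (0:ℝ) 1, (κ x).2 = cutL p (2 * 1 * x) γb +
      ∫ s in (0:ℝ)..x, b s • opA p (2 * 1 * s) (κ s).1 := by
    intro x hx
    have e := (ContinuousLinearMap.snd ℝ (XLp p) (XLp p)).intervalIntegral_comp_comm (hi x)
    simp only [ContinuousLinearMap.coe_snd'] at e
    rw [e]
    conv_lhs => rw [hκeq x hx]
    rfl
  exact ⟨fun x => (κ x).1, fun x => (κ x).2, hκ.fst, hκ.snd, heq1, heq2⟩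

lemma scalar_unique {a b : ℝ → ℂ} (ha : Integrable a) (hb : Integrable b) (l : ℂ)
    {v₁ v₂ y₁ y₂ : ℝ → ℂ} (hv₁ : ContinuousOn v₁ (Icc 0 1)) (hv₂ : ContinuousOn v₂ (Icc 0 1))
    (hy1c : Continuous y₁) (hy2c : Continuous y₂)
    (hv₁eq : ∀ x ∈ Icc (0:ℝ) 1, v₁ x = 1 + ∫ s in (0:ℝ)..x,
      a s * Complex.exp (Complex.I * l * (2 * (-1) * s : ℝ)) * v₂ s)
    (hv₂eq : ∀ x ∈ Icc (0:ℝ) 1, v₂ x = 1 + ∫ s in (0:ℝ)..x,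
      b s * Complex.exp (Complex.I * l * (2 * 1 * s : ℝ)) * v₁ s)
    (hf1 : ∀ x ∈ Icc (0:ℝ) 1, y₁ x = ∫ s in (0:ℝ)..x,
      a s * Complex.exp (Complex.I * l * (2 * (-1) * s : ℝ)) * (1 + y₂ s))
    (hf2 : ∀ x ∈ Icc (0:ℝ) 1, y₂ x = ∫ s in (0:ℝ)..x,
      b s * Complex.exp (Complex.I * l * (2 * 1 * s : ℝ)) * (1 + y₁ s)) :
    ∀ x ∈ Icc (0:ℝ) 1, v₁ x = 1 + y₁ x ∧ v₂ x = 1 + y₂ x := by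
  have h0 : ∀ s, 0 ≤ ‖a s‖ + ‖b s‖ := fun s => by positivity
  set d₁ : ℝ → ℂ := fun x => v₁ x - (1 + y₁ x) with hd₁
  set d₂ : ℝ → ℂ := fun x => v₂ x - (1 + y₂ x) with hd₂
  have hd₁c : ContinuousOn d₁ (Icc 0 1) := hv₁.sub (continuous_const.add hy1c).continuousOn
  have hd₂c : ContinuousOn d₂ (Icc 0 1) := hv₂.sub (continuous_const.add hy2c).continuousOn
  have hexp : ∀ c : ℝ, Continuous fun s : ℝ => Complex.exp (Complex.I * l * (c * s : ℝ)) := by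
    intro c; fun_prop
  have hgen : ∀ (a : ℝ → ℂ), Integrable a → ∀ (c : ℝ) (v w : ℝ → ℂ), ContinuousOn v (Icc 0 1) →
      Continuous w → ∀ x ∈ Icc (0:ℝ) 1,
      (1 + ∫ s in (0:ℝ)..x, a s * Complex.exp (Complex.I * l * (c * s : ℝ)) * v s) -
      (1 + ∫ s in (0:ℝ)..x, a s * Complex.exp (Complex.I * l * (c * s : ℝ)) * w s) =
      ∫ s in (0:ℝ)..x, a s * Complex.exp (Complex.I * l * (c * s : ℝ)) * (v s - w s) := by
    intro a ha c v w hv hw x hx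
    rw [add_sub_add_left_eq_sub, ← intervalIntegral.integral_sub]
    · simp_rw [mul_sub]
    · refine (ha.intervalIntegrable.mul_continuousOn (hexp c).continuousOn).mul_continuousOn ?_
      rw [uIcc_of_le hx.1]
      exact hv.mono (Icc_subset_Icc_right hx.2)
    · exact (ha.intervalIntegrable.mul_continuousOn (hexp c).continuousOn).mul_continuousOn
        hw.continuousOn
  have k1 : ∀ x ∈ Icc (0:ℝ) 1, d₁ x = ∫ s in (0:ℝ)..x,
      a s * Complex.exp (Complex.I * l * (2 * (-1) * s : ℝ)) * d₂ s := by
    intro x hx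
    rw [← hgen a ha (2 * (-1)) v₂ (fun s => 1 + y₂ s) hv₂ (continuous_const.add hy2c) x hx, ← hf1 x hx,
      ← hv₁eq x hx]
  have k2 : ∀ x ∈ Icc (0:ℝ) 1, d₂ x = ∫ s in (0:ℝ)..x,
      b s * Complex.exp (Complex.I * l * (2 * 1 * s : ℝ)) * d₁ s := by
    intro x hx
    rw [← hgen b hb (2 * 1) v₁ (fun s => 1 + y₁ s) hv₁ (continuous_const.add hy1c) x hx, ← hf2 x hx,
      ← hv₂eq x hx]
  obtain ⟨M₁, hM₁⟩ := (isCompact_Icc (a := (0:ℝ)) (b := 1)).exists_bound_of_continuousOn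
    (hexp (2 * (-1))).continuousOn
  obtain ⟨M₂, hM₂⟩ := (isCompact_Icc (a := (0:ℝ)) (b := 1)).exists_bound_of_continuousOn
    (hexp (2 * 1)).continuousOn
  set M := max M₁ M₂
  have hM0 : 0 ≤ M := (norm_nonneg _).trans ((hM₁ 0 (by simp)).trans (le_max_left _ _))
  have hbound : ∀ (a : ℝ → ℂ), Integrable a → ∀ (c : ℝ) (d : ℝ → ℂ), ContinuousOn d (Icc 0 1) →
      (∀ s ∈ Icc (0:ℝ) 1, ‖Complex.exp (Complex.I * l * (c * s : ℝ))‖ ≤ M) →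
      ∀ x ∈ Icc (0:ℝ) 1,
      ‖∫ s in (0:ℝ)..x, a s * Complex.exp (Complex.I * l * (c * s : ℝ)) * d s‖ ≤
        ∫ s in (0:ℝ)..x, M * ‖a s‖ * ‖d s‖ := by
    intro a ha c d hd hM x hx
    refine intervalIntegral.norm_integral_le_of_norm_le hx.1 (Eventually.of_forall fun s hs => ?_) ?_
    · rw [norm_mul, norm_mul]
      have := hM s ⟨hs.1.le, hs.2.trans hx.2⟩
      have h2 := mul_le_mul_of_nonneg_left this (norm_nonneg (a s))
      have h3 := mul_le_mul_of_nonneg_right h2 (norm_nonneg (d s))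
      linarith
    · refine (ha.norm.const_mul M).intervalIntegrable.mul_continuousOn ?_
      rw [uIcc_of_le hx.1]
      exact (hd.mono (Icc_subset_Icc_right hx.2)).norm
  have hzero := gronwall_zero (h := fun s => M * (‖a s‖ + ‖b s‖)) (D := fun s => ‖d₁ s‖ + ‖d₂ s‖)
    ((ha.norm.add hb.norm).const_mul M) (fun s => mul_nonneg hM0 (h0 s)) (hd₁c.norm.add hd₂c.norm)
    (fun s => by positivity) (fun x hx => by
      have b1 := hbound a ha _ d₂ hd₂c (fun s hs => (hM₁ s hs).trans (le_max_left _ _)) x hx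
      have b2 := hbound b hb _ d₁ hd₁c (fun s hs => (hM₂ s hs).trans (le_max_right _ _)) x hx
      rw [← k1 x hx] at b1
      rw [← k2 x hx] at b2
      have hsub : uIcc 0 x ⊆ Icc (0:ℝ) 1 := by
        rw [uIcc_of_le hx.1]; exact Icc_subset_Icc_right hx.2
      refine (add_le_add b1 b2).trans ?_
      rw [← intervalIntegral.integral_add]
      · refine intervalIntegral.integral_mono_on hx.1 ?_ ?_ fun s hs => ?_
        · exact ((ha.norm.const_mul M).intervalIntegrable.mul_continuousOn
            (hd₂c.mono hsub).norm).add ((hb.norm.const_mul M).intervalIntegrable.mul_continuousOn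
            (hd₁c.mono hsub).norm)
        · exact ((ha.norm.add hb.norm).const_mul M).intervalIntegrable.mul_continuousOn
            ((hd₁c.mono hsub).norm.add (hd₂c.mono hsub).norm)
        · have m1 := mul_nonneg (mul_nonneg hM0 (norm_nonneg (a s))) (norm_nonneg (d₁ s))
          have m2 := mul_nonneg (mul_nonneg hM0 (norm_nonneg (b s))) (norm_nonneg (d₂ s))
          nlinarith
      · exact (ha.norm.const_mul M).intervalIntegrable.mul_continuousOn (hd₂c.mono hsub).norm
      · exact (hb.norm.const_mul M).intervalIntegrable.mul_continuousOn (hd₁c.mono hsub).norm)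
  intro x hx
  have hz := hzero x hx
  have n1 := norm_nonneg (d₁ x)
  have n2 := norm_nonneg (d₂ x)
  have z1 : d₁ x = 0 := norm_eq_zero.1 (by linarith)
  have z2 : d₂ x = 0 := norm_eq_zero.1 (by linarith)
  exact ⟨sub_eq_zero.1 z1, sub_eq_zero.1 z2⟩

/-- Existence of the kernels in the diagonalized picture. -/
lemma exists_kernels (hp' : p ≠ ∞) {a b : ℝ → ℂ} (ha : Integrable a) (hb : Integrable b)
    (hap : MemLp a p volume) (hbp : MemLp b p volume) :
    ∃ κ₁ κ₂ : ℝ → XLp p,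
      (∀ x ∈ Icc (0:ℝ) 1, cutL p (-(2 * x)) (κ₁ x) = κ₁ x ∧ cutL p (2 * x) (κ₂ x) = κ₂ x) ∧
      ∀ (l : ℂ) (v₁ v₂ : ℝ → ℂ), ContinuousOn v₁ (Icc 0 1) → ContinuousOn v₂ (Icc 0 1) →
        (∀ x ∈ Icc (0:ℝ) 1, v₁ x = 1 + ∫ s in (0:ℝ)..x,
          a s * Complex.exp (Complex.I * l * (2 * (-1) * s : ℝ)) * v₂ s) →
        (∀ x ∈ Icc (0:ℝ) 1, v₂ x = 1 + ∫ s in (0:ℝ)..x,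
          b s * Complex.exp (Complex.I * l * (2 * 1 * s : ℝ)) * v₁ s) →
        ∀ x ∈ Icc (0:ℝ) 1, v₁ x = 1 + fourL p l (κ₁ x) ∧ v₂ x = 1 + fourL p l (κ₂ x) := by
  have hγa := memLp_scale hap (σ := -1) (Or.inr rfl)
  have hγb := memLp_scale hbp (σ := 1) (Or.inl rfl)
  let γa : XLp p := hγa.toLp _
  let γb : XLp p := hγb.toLp _
  obtain ⟨κ₁, κ₂, hκ₁, hκ₂, heq1, heq2⟩ := exists_volterra_pair hp' ha hb γa γb
  have hs1 := rep_support hp' ha (σ := -1) (Or.inr rfl) hκ₂ heq1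
  have hs2 := rep_support hp' hb (σ := 1) (Or.inl rfl) hκ₁ heq2
  refine ⟨κ₁, κ₂, fun x hx => ⟨?_, ?_⟩, ?_⟩
  · have := hs1 x hx
    rwa [show 2 * (-1) * x = -(2 * x) by ring] at this
  · have := hs2 x hx
    rwa [show 2 * 1 * x = 2 * x by ring] at this
  intro l v₁ v₂ hv₁ hv₂ hv₁eq hv₂eq
  have hf1 := rep_fourier hp' ha (σ := -1) (Or.inr rfl) hγa.coeFn_toLp hκ₂ heq1 (fun x hx => by
    have := hs2 x hx
    rwa [show -(2 * (-1) * x) = 2 * 1 * x by ring]) l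
  have hf2 := rep_fourier hp' hb (σ := 1) (Or.inl rfl) hγb.coeFn_toLp hκ₁ heq2 (fun x hx => by
    have := hs1 x hx
    rwa [show -(2 * 1 * x) = 2 * (-1) * x by ring]) l
  have hy1c : Continuous fun x => fourL p l (κ₁ x) := (fourL p l).continuous.comp hκ₁
  have hy2c : Continuous fun x => fourL p l (κ₂ x) := (fourL p l).continuous.comp hκ₂
  exact scalar_unique ha hb l hv₁ hv₂ hy1c hy2c hv₁eq hv₂eq hf1 hf2

end Rep

section Final

lemma comb_ac {u u' : ℝ → Fin 2 → ℂ} (hu' : IntegrableOn u' (Set.Ioo 0 1))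
    (hu : ∀ x ∈ Set.Icc (0:ℝ) 1, u x = u 0 + ∫ t in (0:ℝ)..x, u' t) (e : ℂ) :
    Integrable ((Ioc (0:ℝ) 1).indicator fun t => u' t 0 + e * u' t 1) ∧
    ∀ x ∈ Icc (0:ℝ) 1, u x 0 + e * u x 1 = (u 0 0 + e * u 0 1) +
      ∫ t in (0:ℝ)..x, (Ioc (0:ℝ) 1).indicator (fun t => u' t 0 + e * u' t 1) t := by
  have h1 : IntegrableOn u' (Ioc 0 1) := by
    rw [integrableOn_Ioc_iff_integrableOn_Ioo]; exact hu'
  have hc : ∀ i, IntegrableOn (fun t => u' t i) (Ioc 0 1) := fun i =>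
    (ContinuousLinearMap.proj (R := ℂ) (φ := fun _ : Fin 2 => ℂ) i).integrable_comp h1
  have hI : IntegrableOn (fun t => u' t 0 + e * u' t 1) (Ioc 0 1) :=
    (hc 0).add ((hc 1).const_mul e)
  refine ⟨(integrable_indicator_iff measurableSet_Ioc).2 hI, fun x hx => ?_⟩
  have hsub : Ioc 0 x ⊆ Ioc (0:ℝ) 1 := Ioc_subset_Ioc_right hx.2
  have hii : ∀ i, IntervalIntegrable (fun t => u' t i) volume 0 x := fun i =>
    (intervalIntegrable_iff_integrableOn_Ioc_of_le hx.1).2 ((hc i).mono_set hsub)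
  have hiu : IntervalIntegrable u' volume 0 x :=
    (intervalIntegrable_iff_integrableOn_Ioc_of_le hx.1).2 (h1.mono_set hsub)
  have hcomp : ∀ i, u x i = u 0 i + ∫ t in (0:ℝ)..x, u' t i := by
    intro i
    have h2 := (ContinuousLinearMap.proj (R := ℂ) (φ := fun _ : Fin 2 => ℂ)
      i).intervalIntegral_comp_comm hiu
    simp only [ContinuousLinearMap.proj_apply] at h2
    rw [h2]
    exact congrFun (hu x hx) i
  have h3 : ∫ t in (0:ℝ)..x, (Ioc (0:ℝ) 1).indicator (fun t => u' t 0 + e * u' t 1) t =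
      ∫ t in (0:ℝ)..x, (u' t 0 + e * u' t 1) := by
    refine intervalIntegral.integral_congr_ae (Eventually.of_forall fun t ht => ?_)
    rw [uIoc_of_le hx.1] at ht
    rw [indicator_of_mem (hsub ht)]
  rw [h3, intervalIntegral.integral_add (hii 0) ((hii 1).const_mul e),
    intervalIntegral.integral_const_mul, hcomp 0, hcomp 1]
  ring

lemma comb_cont {w w' : ℝ → ℂ} (hw' : Integrable w') (w0 : ℂ)
    (hw : ∀ x ∈ Icc (0:ℝ) 1, w x = w0 + ∫ s in (0:ℝ)..x, w' s) (m : ℂ) :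
    ContinuousOn (fun x : ℝ => Complex.exp (m * x) * w x) (Icc 0 1) := by
  refine ContinuousOn.mul (by fun_prop) ?_
  have h1 : Continuous fun x => w0 + ∫ s in (0:ℝ)..x, w' s :=
    continuous_const.add (intervalIntegral.continuous_primitive
      (fun _ _ => hw'.intervalIntegrable) 0)
  exact h1.continuousOn.congr hw

lemma sol_v {Q : ℝ → M2} {q1 q2 a b : ℝ → ℂ}
    (hQ : ∀ x, Q x = !![q1 x, q2 x; q2 x, -q1 x])
    (ha : ∀ x ∈ Ioo (0:ℝ) 1, a x = q2 x - Complex.I * q1 x)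
    (hb : ∀ x ∈ Ioo (0:ℝ) 1, b x = q2 x + Complex.I * q1 x)
    {l : ℂ} {c : ℝ → Fin 2 → ℂ} (hc : IsVecSolution Q l c) (hc0 : c 0 = ![1, 0])
    {v₁ v₂ : ℝ → ℂ}
    (hv₁ : v₁ = fun x : ℝ => Complex.exp (-(Complex.I * l) * x) * (c x 0 + Complex.I * c x 1))
    (hv₂ : v₂ = fun x : ℝ => Complex.exp ((Complex.I * l) * x) * (c x 0 + -Complex.I * c x 1)) :
    ContinuousOn v₁ (Icc 0 1) ∧ ContinuousOn v₂ (Icc 0 1) ∧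
    (∀ x ∈ Icc (0:ℝ) 1, v₁ x = 1 + ∫ s in (0:ℝ)..x,
          a s * Complex.exp (Complex.I * l * (2 * (-1) * s : ℝ)) * v₂ s) ∧
    (∀ x ∈ Icc (0:ℝ) 1, v₂ x = 1 + ∫ s in (0:ℝ)..x,
          b s * Complex.exp (Complex.I * l * (2 * 1 * s : ℝ)) * v₁ s) := by
  obtain ⟨u', hu', hu, hode⟩ := hc
  obtain ⟨hi1, he1⟩ := comb_ac hu' hu Complex.I
  obtain ⟨hi2, he2⟩ := comb_ac hu' hu (-Complex.I)
  have z0 : c 0 0 = 1 := by rw [hc0]; rfl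
  have z1 : c 0 1 = 0 := by rw [hc0]; rfl
  have hae : ∀ᵐ x : ℝ, x ∈ Ioo (0:ℝ) 1 →
      (u' x 1 + (q1 x * c x 0 + q2 x * c x 1) = l * c x 0 ∧
      -u' x 0 + (q2 x * c x 0 - q1 x * c x 1) = l * c x 1) := by
    rw [μ01, ae_restrict_iff' measurableSet_Ioo] at hode
    filter_upwards [hode] with x hx hx1
    have h := hx hx1
    have r0 := congrFun h 0
    have r1 := congrFun h 1
    simp [hQ, Bmat, dotProduct, Fin.sum_univ_two] at r0 r1
    exact ⟨r0, by linear_combination r1⟩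
  refine ⟨?_, ?_, ?_, ?_⟩
  · rw [hv₁]; exact comb_cont hi1 _ he1 _
  · rw [hv₂]; exact comb_cont hi2 _ he2 _
  · intro x hx
    have h := exp_mul_ac (w := fun x => c x 0 + Complex.I * c x 1) (-(Complex.I * l)) hi1 he1 x hx
    rw [hv₁, hv₂]
    simp only at h ⊢
    rw [h, z0, z1, mul_zero, add_zero]
    congr 1
    refine intervalIntegral.integral_congr_ae ?_
    filter_upwards [hae, ae_ne_volume 1] with s hs hs1 hs2
    rw [uIoc_of_le hx.1] at hs2
    have hs3 : s ∈ Ioo (0:ℝ) 1 := ⟨hs2.1, lt_of_le_of_ne (hs2.2.trans hx.2) hs1⟩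
    obtain ⟨e0, e1⟩ := hs hs3
    rw [indicator_of_mem (Ioo_subset_Ioc_self hs3), ha s hs3]
    have hexp : Complex.exp (-(Complex.I * l) * s) =
        Complex.exp (Complex.I * l * (2 * (-1) * s : ℝ)) * Complex.exp ((Complex.I * l) * s) := by
      rw [← Complex.exp_add]; congr 1; push_cast; ring
    rw [hexp]
    have hI := Complex.I_mul_I
    have e0' : u' s 1 = l * c s 0 - (q1 s * c s 0 + q2 s * c s 1) := by linear_combination e0
    have e1' : u' s 0 = (q2 s * c s 0 - q1 s * c s 1) - l * c s 1 := by linear_combination -e1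
    rw [e0', e1']
    linear_combination (-Complex.exp (Complex.I * l * (2 * (-1) * s : ℝ)) *
      Complex.exp ((Complex.I * l) * s) * (l * c s 1 + q1 s * c s 1)) * hI
  · intro x hx
    have h := exp_mul_ac (w := fun x => c x 0 + -Complex.I * c x 1) (Complex.I * l) hi2 he2 x hx
    rw [hv₁, hv₂]
    simp only at h ⊢
    rw [h, z0, z1, mul_zero, add_zero]
    congr 1
    refine intervalIntegral.integral_congr_ae ?_
    filter_upwards [hae, ae_ne_volume 1] with s hs hs1 hs2
    rw [uIoc_of_le hx.1] at hs2
    have hs3 : s ∈ Ioo (0:ℝ) 1 := ⟨hs2.1, lt_of_le_of_ne (hs2.2.trans hx.2) hs1⟩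
    obtain ⟨e0, e1⟩ := hs hs3
    rw [indicator_of_mem (Ioo_subset_Ioc_self hs3), hb s hs3]
    have hexp : Complex.exp ((Complex.I * l) * s) =
        Complex.exp (Complex.I * l * (2 * 1 * s : ℝ)) * Complex.exp (-(Complex.I * l) * s) := by
      rw [← Complex.exp_add]; congr 1; push_cast; ring
    rw [hexp]
    have hI := Complex.I_mul_I
    have e0' : u' s 1 = l * c s 0 - (q1 s * c s 0 + q2 s * c s 1) := by linear_combination e0
    have e1' : u' s 0 = (q2 s * c s 0 - q1 s * c s 1) - l * c s 1 := by linear_combination -e1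
    rw [e0', e1']
    linear_combination (-Complex.exp (Complex.I * l * (2 * 1 * s : ℝ)) *
      Complex.exp (-(Complex.I * l) * s) * (l * c s 1 + q1 s * c s 1)) * hI

variable {p : ℝ≥0∞} [hp1 : Fact (1 ≤ p)]

lemma ker_shift (l : ℂ) {y : ℝ} (hy : |y| ≤ 1) {κ : XLp p}
    (hκ : cutL p (-(2 * y)) κ = κ) :
    Complex.exp (Complex.I * l * y) * fourL p l κ =
      ∫ t in (-|y|)..|y|, Complex.exp (Complex.I * l * t) * κ (t - y) := by
  have h1 : (κ : ℝ → ℂ) =ᵐ[volume] (uIoc 0 (-(2 * y))).indicator κ := by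
    conv_lhs => rw [← hκ]
    exact cutL_coeFn _ _
  rw [fourL_congr l h1]
  swap
  · intro t ht
    rw [indicator_of_notMem]
    intro h5
    simp only [mem_uIoc, mem_Ioc, abs_le] at h5 ht hy
    grind
  rw [← integral_const_mul, intervalIntegral.integral_of_le (by linarith [abs_nonneg y]),
    ← integral_indicator measurableSet_Ioc,
    ← integral_sub_right_eq_self (fun t : ℝ => Complex.exp (Complex.I * l * y) *
      (Complex.exp (Complex.I * l * t) * (uIoc 0 (-(2 * y))).indicator κ t)) y]
  refine integral_congr_ae ?_
  filter_upwards [ae_ne_volume y, ae_ne_volume (-y)] with t ht1 ht2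
  have hiff : t - y ∈ uIoc 0 (-(2 * y)) ↔ t ∈ Ioc (-|y|) |y| := by
    simp only [mem_uIoc, mem_Ioc]
    grind
  by_cases ht : t ∈ Ioc (-|y|) |y|
  · rw [indicator_of_mem ht, indicator_of_mem (hiff.2 ht), ← mul_assoc, ← Complex.exp_add]
    congr 2
    push_cast; ring
  · rw [indicator_of_notMem ht, indicator_of_notMem (fun h => ht (hiff.1 h)), mul_zero, mul_zero]

lemma fold_int (l : ℂ) {m : ℝ → ℂ} (hm : ∀ x y, IntervalIntegrable m volume x y) (x : ℝ) :
    ∫ t in (-x)..x, Complex.exp (Complex.I * l * t) * m t =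
      ∫ t in (0:ℝ)..x, ((m t + m (-t)) * Complex.cos (l * t) +
        Complex.I * (m t - m (-t)) * Complex.sin (l * t)) := by
  have hF : ∀ x y, IntervalIntegrable (fun t : ℝ => Complex.exp (Complex.I * l * t) * m t)
      volume x y := fun x y => (hm x y).continuousOn_mul (by fun_prop)
  rw [← intervalIntegral.integral_add_adjacent_intervals (hF (-x) 0) (hF 0 x)]
  have h1 := intervalIntegral.integral_comp_neg (a := 0) (b := x)
    (fun t : ℝ => Complex.exp (Complex.I * l * t) * m t)
  rw [neg_zero] at h1
  have hG : IntervalIntegrable (fun t : ℝ => Complex.exp (Complex.I * l * (-t : ℝ)) * m (-t))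
      volume 0 x := by
    have := IntervalIntegrable.comp_sub_left (hF 0 (-x)) 0
    simpa using this
  rw [← h1, ← intervalIntegral.integral_add hG (hF 0 x)]
  refine intervalIntegral.integral_congr fun t _ => ?_
  have e1 : Complex.exp (Complex.I * l * t) = Complex.cos (l * t) + Complex.sin (l * t) * Complex.I := by
    rw [← Complex.exp_mul_I]; congr 1; ring
  have e2 : Complex.exp (Complex.I * l * (-t : ℝ)) =
      Complex.cos (l * t) - Complex.sin (l * t) * Complex.I := by
    have := Complex.exp_mul_I (-(l * t))
    rw [Complex.cos_neg, Complex.sin_neg] at this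
    rw [sub_eq_add_neg, ← neg_mul, ← this]
    congr 1; push_cast; ring
  rw [e1, e2]
  ring

lemma memLp_matrix {μ : Measure ℝ} {f g h k : ℝ → ℂ} (hf : MemLp f p μ) (hg : MemLp g p μ)
    (hh : MemLp h p μ) (hk : MemLp k p μ) :
    MemLp (fun t => (!![f t, g t; h t, k t] : M2)) p μ := by
  have key : ∀ (A : M2) {f : ℝ → ℂ}, MemLp f p μ → MemLp (fun t => f t • A) p μ := fun A f hf =>
    (ContinuousLinearMap.toSpanSingleton ℂ A).comp_memLp' hf
  have := (((key !![1, 0; 0, 0] hf).add (key !![0, 1; 0, 0] hg)).add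
    (key !![0, 0; 1, 0] hh)).add (key !![0, 0; 0, 1] hk)
  convert this using 1
  funext t
  ext i j
  fin_cases i <;> fin_cases j <;> simp

lemma memLp_entry {μ : Measure ℝ} {Q : ℝ → M2} (hQ : MemLp Q p μ) (i j : Fin 2) :
    MemLp (fun t => Q t i j) p μ :=
  (LinearMap.toContinuousLinearMap (Matrix.entryLinearMap ℂ ℂ i j : M2 →ₗ[ℂ] ℂ)).comp_memLp' hQ

end Final
/-- Existence of a transformation-operator kernel `K` with
`c(x,λ) = c₀(x,λ) + ∫₀ˣ K(x,t) c₀(t,λ) dt`. -/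
theorem statement2 (p : ℝ≥0∞) (hp : 1 ≤ p) (hp' : p ≠ ∞)
    (Q : ℝ → M2) (hQform : IsDiracForm Q) (hQp : MemLp Q p μ01) :
    ∃ K : ℝ → ℝ → M2,
      (∀ x ∈ Set.Icc (0:ℝ) 1, MemLp (K x) p (volume.restrict (Set.Ioo 0 x))) ∧
      ∀ l : ℂ, ∀ c : ℝ → Fin 2 → ℂ, IsVecSolution Q l c → c 0 = ![1, 0] →
        ∀ x ∈ Set.Icc (0:ℝ) 1,
          c x = c0 l x + ∫ t in (0:ℝ)..x, (K x t).mulVec (c0 l t) := by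
  have hp1 : Fact (1 ≤ p) := ⟨hp⟩
  obtain ⟨q1, q2, hQ⟩ := hQform
  have hq1 : MemLp q1 p (volume.restrict (Ioo (0:ℝ) 1)) := by
    have := memLp_entry hQp 0 0
    simp only [hQ] at this
    exact this
  have hq2 : MemLp q2 p (volume.restrict (Ioo (0:ℝ) 1)) := by
    have := memLp_entry hQp 0 1
    simp only [hQ] at this
    exact this
  have ha0 : MemLp (fun x => q2 x - Complex.I * q1 x) p (volume.restrict (Ioo (0:ℝ) 1)) :=
    hq2.sub (hq1.const_mul Complex.I)
  have hb0 : MemLp (fun x => q2 x + Complex.I * q1 x) p (volume.restrict (Ioo (0:ℝ) 1)) :=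
    hq2.add (hq1.const_mul Complex.I)
  have ha : Integrable ((Ioo (0:ℝ) 1).indicator fun x => q2 x - Complex.I * q1 x) :=
    (integrable_indicator_iff measurableSet_Ioo).2 (ha0.integrable hp)
  have hb : Integrable ((Ioo (0:ℝ) 1).indicator fun x => q2 x + Complex.I * q1 x) :=
    (integrable_indicator_iff measurableSet_Ioo).2 (hb0.integrable hp)
  obtain ⟨κ₁, κ₂, hsupp, hrep⟩ := exists_kernels (p := p) hp' ha hb
    ((memLp_indicator_iff_restrict measurableSet_Ioo).2 ha0)
    ((memLp_indicator_iff_restrict measurableSet_Ioo).2 hb0)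
  let k₁ : ℝ → ℝ → ℂ := fun x t => κ₁ x (t - x)
  let k₂ : ℝ → ℝ → ℂ := fun x t => κ₂ x (t - -x)
  have hk₁ : ∀ x, MemLp (k₁ x) p volume := fun x =>
    (Lp.memLp (κ₁ x)).comp_measurePreserving (measurePreserving_sub_right volume x)
  have hk₂ : ∀ x, MemLp (k₂ x) p volume := fun x =>
    (Lp.memLp (κ₂ x)).comp_measurePreserving (measurePreserving_sub_right volume (-x))
  let m₁ : ℝ → ℝ → ℂ := fun x t => (1 / 2 : ℂ) * (k₁ x t + k₂ x t)
  let m₂ : ℝ → ℝ → ℂ := fun x t => (-Complex.I / 2) * (k₁ x t - k₂ x t)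
  have hm₁ : ∀ x, MemLp (m₁ x) p volume := fun x => ((hk₁ x).add (hk₂ x)).const_mul _
  have hm₂ : ∀ x, MemLp (m₂ x) p volume := fun x => ((hk₁ x).sub (hk₂ x)).const_mul _
  have hneg : ∀ {m : ℝ → ℂ}, MemLp m p volume → MemLp (fun t => m (-t)) p volume := fun hm =>
    hm.comp_measurePreserving (Measure.measurePreserving_neg volume)
  have hint : ∀ {m : ℝ → ℂ}, MemLp m p volume → ∀ x y, IntervalIntegrable m volume x y := by
    intro m hm x y
    rw [intervalIntegrable_iff, uIoc]
    exact (hm.restrict _).integrable hp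
  let K : ℝ → ℝ → M2 := fun x t =>
    !![m₁ x t + m₁ x (-t), Complex.I * (m₁ x t - m₁ x (-t));
       m₂ x t + m₂ x (-t), Complex.I * (m₂ x t - m₂ x (-t))]
  have hK : ∀ x, MemLp (K x) p volume := fun x =>
    memLp_matrix ((hm₁ x).add (hneg (hm₁ x)))
      (((hm₁ x).sub (hneg (hm₁ x))).const_mul Complex.I)
      ((hm₂ x).add (hneg (hm₂ x)))
      (((hm₂ x).sub (hneg (hm₂ x))).const_mul Complex.I)
  refine ⟨K, fun x _ => (hK x).restrict _, ?_⟩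
  intro l c hc hc0 x hx
  obtain ⟨hv₁, hv₂, hv₁eq, hv₂eq⟩ := sol_v hQ
    (a := (Ioo (0:ℝ) 1).indicator fun x => q2 x - Complex.I * q1 x)
    (b := (Ioo (0:ℝ) 1).indicator fun x => q2 x + Complex.I * q1 x)
    (fun x hx => indicator_of_mem hx _) (fun x hx => indicator_of_mem hx _) hc hc0 rfl rfl
  obtain ⟨r1, r2⟩ := hrep l _ _ hv₁ hv₂ hv₁eq hv₂eq x hx
  have habs : |x| = x := abs_of_nonneg hx.1
  have s1 := ker_shift l (y := x) (by rw [habs]; exact hx.2) (hsupp x hx).1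
  have s2 := ker_shift l (y := -x) (by rw [abs_neg, habs]; exact hx.2) (κ := κ₂ x) (by
    rw [show -(2 * -x) = 2 * x by ring]; exact (hsupp x hx).2)
  rw [abs_neg] at s2
  rw [habs] at s1 s2
  have hE : ∀ {m : ℝ → ℂ}, MemLp m p volume →
      IntervalIntegrable (fun t : ℝ => Complex.exp (Complex.I * l * t) * m t) volume (-x) x :=
    fun hm => (hint hm (-x) x).continuousOn_mul (by fun_prop)
  set J1 := ∫ t in (-x)..x, Complex.exp (Complex.I * l * t) * k₁ x t with hJ1
  set J2 := ∫ t in (-x)..x, Complex.exp (Complex.I * l * t) * k₂ x t with hJ2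
  have s1' : Complex.exp (Complex.I * l * x) * fourL p l (κ₁ x) = J1 := s1
  have s2' : Complex.exp (Complex.I * l * (-x : ℝ)) * fourL p l (κ₂ x) = J2 := s2
  have w1 : c x 0 + Complex.I * c x 1 = Complex.exp (Complex.I * l * x) + J1 := by
    rw [← s1']
    have h : Complex.exp (Complex.I * l * x) * Complex.exp (-(Complex.I * l) * x) = 1 := by
      rw [← Complex.exp_add, ← Complex.exp_zero]; congr 1; ring
    linear_combination (Complex.exp (Complex.I * l * x)) * r1 - (c x 0 + Complex.I * c x 1) * h
  have w2 : c x 0 - Complex.I * c x 1 = Complex.exp (Complex.I * l * (-x : ℝ)) + J2 := by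
    rw [← s2']
    have h : Complex.exp (Complex.I * l * (-x : ℝ)) * Complex.exp ((Complex.I * l) * x) = 1 := by
      rw [← Complex.exp_add, ← Complex.exp_zero]; congr 1; push_cast; ring
    linear_combination (Complex.exp (Complex.I * l * (-x : ℝ))) * r2
      - (c x 0 - Complex.I * c x 1) * h
  have e1 : Complex.exp (Complex.I * l * x) =
      Complex.cos (l * x) + Complex.sin (l * x) * Complex.I := by
    rw [← Complex.exp_mul_I]; congr 1; ring
  have e2 : Complex.exp (Complex.I * l * (-x : ℝ)) =
      Complex.cos (l * x) - Complex.sin (l * x) * Complex.I := by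
    have := Complex.exp_mul_I (-(l * x))
    rw [Complex.cos_neg, Complex.sin_neg] at this
    rw [sub_eq_add_neg, ← neg_mul, ← this]
    congr 1; push_cast; ring
  have M1 : ∫ t in (-x)..x, Complex.exp (Complex.I * l * t) * m₁ x t = (1 / 2 : ℂ) * (J1 + J2) := by
    rw [hJ1, hJ2, ← intervalIntegral.integral_add (hE (hk₁ x)) (hE (hk₂ x)),
      ← intervalIntegral.integral_const_mul]
    refine intervalIntegral.integral_congr fun t _ => ?_
    simp only [m₁]; ring
  have M2' : ∫ t in (-x)..x, Complex.exp (Complex.I * l * t) * m₂ x t =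
      (-Complex.I / 2) * (J1 - J2) := by
    rw [hJ1, hJ2, ← intervalIntegral.integral_sub (hE (hk₁ x)) (hE (hk₂ x)),
      ← intervalIntegral.integral_const_mul]
    refine intervalIntegral.integral_congr fun t _ => ?_
    simp only [m₂]; ring
  have hcos : Continuous fun t : ℝ => Complex.cos (l * t) := by fun_prop
  have hsin : Continuous fun t : ℝ => Complex.sin (l * t) := by fun_prop
  have hG : ∀ {m : ℝ → ℂ}, MemLp m p volume → IntervalIntegrable
      (fun t : ℝ => (m t + m (-t)) * Complex.cos (l * t) +
        Complex.I * (m t - m (-t)) * Complex.sin (l * t)) volume 0 x := fun hm =>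
    ((hint (hm.add (hneg hm)) 0 x).mul_continuousOn hcos.continuousOn).add
      ((hint ((hm.sub (hneg hm)).const_mul Complex.I) 0 x).mul_continuousOn hsin.continuousOn)
  have hvec : (fun t : ℝ => (K x t).mulVec (c0 l t)) = fun t : ℝ =>
      ![(m₁ x t + m₁ x (-t)) * Complex.cos (l * t) +
        Complex.I * (m₁ x t - m₁ x (-t)) * Complex.sin (l * t),
        (m₂ x t + m₂ x (-t)) * Complex.cos (l * t) +
        Complex.I * (m₂ x t - m₂ x (-t)) * Complex.sin (l * t)] := by
    funext t
    ext i
    fin_cases i <;> simp [K, c0] <;> ring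
  have hvi : IntervalIntegrable (fun t : ℝ => (K x t).mulVec (c0 l t)) volume 0 x := by
    rw [hvec, intervalIntegrable_iff]
    refine Integrable.of_eval fun i => ?_
    fin_cases i
    · exact intervalIntegrable_iff.1 (hG (hm₁ x))
    · exact intervalIntegrable_iff.1 (hG (hm₂ x))
  have hcomp : ∀ i, (∫ t in (0:ℝ)..x, (K x t).mulVec (c0 l t)) i =
      ∫ t in (0:ℝ)..x, (K x t).mulVec (c0 l t) i := fun i =>
    ((ContinuousLinearMap.proj (R := ℂ) (φ := fun _ : Fin 2 => ℂ)
      i).intervalIntegral_comp_comm hvi).symm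
  have hI := Complex.I_mul_I
  funext i
  rw [Pi.add_apply, hcomp]
  have hvec' := fun t : ℝ => congrFun (congrFun hvec t) i
  simp_rw [hvec']
  fin_cases i
  · have f := fold_int l (hint (hm₁ x)) x
    rw [M1] at f
    refine Eq.trans ?_ (congrArg (fun z => c0 l x 0 + z) f)
    simp only [c0, Matrix.cons_val_zero, Fin.zero_eta]
    linear_combination (1 / 2 : ℂ) * (w1 + w2 + e1 + e2)
  · have f := fold_int l (hint (hm₂ x)) x
    rw [M2'] at f
    refine Eq.trans ?_ (congrArg (fun z => c0 l x 1 + z) f)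
    simp only [c0, Matrix.cons_val_one, Matrix.cons_val_fin_one, Fin.mk_one]
    linear_combination (-Complex.I / 2 : ℂ) * (w1 - w2 + e1 - e2) +
      (c x 1 - Complex.sin (l * x)) * hI
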